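/- Assume there is ε ∈ (0,1) with ‖K* − K̄‖_F ≤ (ε/2)·√(λ_min(Γ)) / (√(λ_min(Γ))·‖S B_a‖_F + ‖S B_u‖_F), let L > 0 be a Lipschitz constant of ∇J̃ on S₀, and assume 0 < ω < (2/L)·λ_min(Γ⁻¹)/λ_max(Γ⁻¹)². Then the gradients along the iteration vanish in the limit: lim_{i→∞} ∇J̃(Λ^i) = 0; equivalently, the stationarity conditions of the deception problem hold in the limit, i.e., ΓΛ^i + B_uᵀP_u(Λ^i)Π(Λ^i) → 0 as i → ∞. -/

import Mathlib

open Matrix Filter Topology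

noncomputable section

/-- A real square matrix is Hurwitz if every complex eigenvalue has strictly
negative real part. -/
def IsHurwitz {N : ℕ} (M : Matrix (Fin N) (Fin N) ℝ) : Prop :=
  ∀ μ : ℂ, μ ∈ spectrum ℂ (M.map (algebraMap ℝ ℂ)) → μ.re < 0

/-- Frobenius norm of a real matrix. -/
def frobNorm {p q : ℕ} (M : Matrix (Fin p) (Fin q) ℝ) : ℝ :=
  Real.sqrt (Matrix.trace (Mᵀ * M))

/-- Minimal eigenvalue of a (Hermitian) real matrix. -/
def eigMin {m : ℕ} (M : Matrix (Fin m) (Fin m) ℝ) : ℝ :=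
  if hM : M.IsHermitian then ⨅ i, hM.eigenvalues i else 0

/-- Maximal eigenvalue of a (Hermitian) real matrix. -/
def eigMax {m : ℕ} (M : Matrix (Fin m) (Fin m) ℝ) : ℝ :=
  if hM : M.IsHermitian then ⨆ i, hM.eigenvalues i else 0

variable {n m_u m_a : ℕ}

/-- `P` is the stabilizing solution of the spoofed ARE for the gain `Λ`. -/
def IsStabSol (A : Matrix (Fin n) (Fin n) ℝ) (Bu : Matrix (Fin n) (Fin m_u) ℝ)
    (Ba : Matrix (Fin n) (Fin m_a) ℝ) (Q : Matrix (Fin n) (Fin n) ℝ)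
    (R : Matrix (Fin m_a) (Fin m_a) ℝ)
    (Λ : Matrix (Fin m_u) (Fin n) ℝ) (P : Matrix (Fin n) (Fin n) ℝ) : Prop :=
  P.PosDef ∧
  (A + Bu * Λ)ᵀ * P + P * (A + Bu * Λ) + Q + P * Ba * R⁻¹ * Baᵀ * P = 0 ∧
  IsHurwitz (A + Bu * Λ + Ba * R⁻¹ * Baᵀ * P)

/-- `Pim` is a symmetric solution of the Lyapunov equation defining `Π(Λ)`,
given the stabilizing ARE solution `P = P_u(Λ)`. -/
def IsLyapSol (A : Matrix (Fin n) (Fin n) ℝ) (Bu : Matrix (Fin n) (Fin m_u) ℝ)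
    (Ba : Matrix (Fin n) (Fin m_a) ℝ) (R : Matrix (Fin m_a) (Fin m_a) ℝ)
    (Kbar : Matrix (Fin m_a) (Fin n) ℝ)
    (Λ : Matrix (Fin m_u) (Fin n) ℝ) (P Pim : Matrix (Fin n) (Fin n) ℝ) : Prop :=
  Pim.IsHermitian ∧
  (A + Bu * Λ + Ba * R⁻¹ * Baᵀ * P) * Pim + Pim * (A + Bu * Λ + Ba * R⁻¹ * Baᵀ * P)ᵀ
    - Kbarᵀ * R⁻¹ * Baᵀ - Ba * R⁻¹ * Kbar
    + P * Ba * (R⁻¹ * R⁻¹) * Baᵀ + Ba * (R⁻¹ * R⁻¹) * Baᵀ * P = 0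

/-- The deception cost `J̃(Λ)`, expressed through a choice function `Pu` for the
stabilizing solution of the spoofed ARE. -/
def Jcost (Ba : Matrix (Fin n) (Fin m_a) ℝ) (R : Matrix (Fin m_a) (Fin m_a) ℝ)
    (Γ : Matrix (Fin m_u) (Fin m_u) ℝ) (Kbar : Matrix (Fin m_a) (Fin n) ℝ)
    (Pu : Matrix (Fin m_u) (Fin n) ℝ → Matrix (Fin n) (Fin n) ℝ)
    (Λ : Matrix (Fin m_u) (Fin n) ℝ) : ℝ :=
  frobNorm (R⁻¹ * Baᵀ * Pu Λ - Kbar) ^ 2 + Matrix.trace (Λᵀ * Γ * Λ)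

/-- The sublevel set `S₀`. -/
def S0 (A : Matrix (Fin n) (Fin n) ℝ) (Bu : Matrix (Fin n) (Fin m_u) ℝ)
    (Ba : Matrix (Fin n) (Fin m_a) ℝ) (Q : Matrix (Fin n) (Fin n) ℝ)
    (R : Matrix (Fin m_a) (Fin m_a) ℝ) (Γ : Matrix (Fin m_u) (Fin m_u) ℝ)
    (Kbar : Matrix (Fin m_a) (Fin n) ℝ)
    (Pu : Matrix (Fin m_u) (Fin n) ℝ → Matrix (Fin n) (Fin n) ℝ) :
    Set (Matrix (Fin m_u) (Fin n) ℝ) :=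
  {Λ | (∃ P, IsStabSol A Bu Ba Q R Λ P) ∧
    Jcost Ba R Γ Kbar Pu Λ ≤ Jcost Ba R Γ Kbar Pu 0}

section QuadraticForms

lemma transpose_eq_of_isHermitian {N : ℕ} {S : Matrix (Fin N) (Fin N) ℝ} (hS : S.IsHermitian) :
    Sᵀ = S := by
  simpa [conjTranspose_eq_transpose_of_trivial] using hS.eq

lemma mulVec_dotProduct_comm_of_isHermitian {N : ℕ} {S : Matrix (Fin N) (Fin N) ℝ}
    (hS : S.IsHermitian) (x y : Fin N → ℝ) : x ⬝ᵥ (S *ᵥ y) = (S *ᵥ x) ⬝ᵥ y := by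
  rw [dotProduct_mulVec, ← mulVec_transpose, transpose_eq_of_isHermitian hS]

lemma dotProduct_lyapunov_mulVec {N : ℕ} {S : Matrix (Fin N) (Fin N) ℝ} (hS : S.IsHermitian)
    (M : Matrix (Fin N) (Fin N) ℝ) (x : Fin N → ℝ) :
    x ⬝ᵥ ((Mᵀ * S + S * M) *ᵥ x) = 2 * ((S *ᵥ x) ⬝ᵥ (M *ᵥ x)) := by
  rw [add_mulVec, dotProduct_add, ← mulVec_mulVec, ← mulVec_mulVec, mulVec_transpose,
    dotProduct_comm x (_ ᵥ* _), ← dotProduct_mulVec, mulVec_dotProduct_comm_of_isHermitian hS]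
  ring

lemma exists_min_quadratic_ratio {N : ℕ} {S : Matrix (Fin N) (Fin N) ℝ} (hS : S.PosDef)
    (Y : Matrix (Fin N) (Fin N) ℝ) (hN : Nonempty (Fin N)) :
    ∃ v : Fin N → ℝ, v ≠ 0 ∧ ∀ w : Fin N → ℝ,
      (v ⬝ᵥ (Y *ᵥ v)) / (v ⬝ᵥ (S *ᵥ v)) * (w ⬝ᵥ (S *ᵥ w)) ≤ w ⬝ᵥ (Y *ᵥ w) := by
  have hpos : ∀ x : Fin N → ℝ, x ≠ 0 → 0 < x ⬝ᵥ (S *ᵥ x) := fun x hx => by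
    simpa using hS.dotProduct_mulVec_pos hx
  have hcont : ∀ M : Matrix (Fin N) (Fin N) ℝ,
      Continuous fun x : Fin N → ℝ => x ⬝ᵥ (M *ᵥ x) := fun M => by fun_prop
  have hne : ∀ x ∈ Metric.sphere (0 : Fin N → ℝ) 1, x ≠ 0 := fun x hx h => by
    simp [h] at hx
  obtain ⟨v, hv, hmin⟩ := (isCompact_sphere (0 : Fin N → ℝ) 1).exists_isMinOn
    (NormedSpace.sphere_nonempty.mpr zero_le_one)
    (f := fun x => (x ⬝ᵥ (Y *ᵥ x)) / (x ⬝ᵥ (S *ᵥ x)))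
    ((hcont Y).continuousOn.div (hcont S).continuousOn fun x hx => (hpos x (hne x hx)).ne')
  refine ⟨v, hne v hv, fun w => ?_⟩
  rcases eq_or_ne w 0 with rfl | hw
  · simp
  have hw0 : 0 < ‖w‖ := norm_pos_iff.mpr hw
  have hmem : ‖w‖⁻¹ • w ∈ Metric.sphere (0 : Fin N → ℝ) 1 := by
    simp [norm_smul, hw0.ne']
  have h := hmin hmem
  simp only [Set.mem_ofPred_eq, mulVec_smul, smul_dotProduct, dotProduct_smul, smul_eq_mul] at h
  rw [mul_div_mul_left _ _ (inv_ne_zero hw0.ne'), mul_div_mul_left _ _ (inv_ne_zero hw0.ne'),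
    le_div_iff₀ (hpos w hw)] at h
  exact h

lemma exists_quadratic_lower_bound {N : ℕ} {M : Matrix (Fin N) (Fin N) ℝ} (hM : M.PosDef) :
    ∃ δ > 0, ∀ x : Fin N → ℝ, δ * (x ⬝ᵥ x) ≤ x ⬝ᵥ (M *ᵥ x) := by
  rcases isEmpty_or_nonempty (Fin N) with hN | hN
  · exact ⟨1, one_pos, fun x => by simp [Subsingleton.elim x 0]⟩
  obtain ⟨v, hv, h⟩ := exists_min_quadratic_ratio (PosDef.one (n := Fin N) (R := ℝ)) M hN
  have h1 : 0 < v ⬝ᵥ (M *ᵥ v) := by simpa using hM.dotProduct_mulVec_pos hv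
  have h2 : 0 < v ⬝ᵥ v := by
    simpa using (PosDef.one (n := Fin N) (R := ℝ)).dotProduct_mulVec_pos hv
  simp only [one_mulVec] at h
  exact ⟨_, div_pos h1 h2, h⟩

/-- A Hermitian solution of a Lyapunov inequality is positive semidefinite when the drift admits a
strict Lyapunov matrix. -/
lemma quadratic_nonneg_of_lyapunov {N : ℕ} {S M Y : Matrix (Fin N) (Fin N) ℝ} (hS : S.PosDef)
    (hSM : ∀ x : Fin N → ℝ, x ≠ 0 → x ⬝ᵥ ((Mᵀ * S + S * M) *ᵥ x) < 0) (hY : Y.IsHermitian)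
    (hYM : ∀ x : Fin N → ℝ, x ⬝ᵥ ((Mᵀ * Y + Y * M) *ᵥ x) ≤ 0) (x : Fin N → ℝ) :
    0 ≤ x ⬝ᵥ (Y *ᵥ x) := by
  rcases isEmpty_or_nonempty (Fin N) with hN | hN
  · simp [Subsingleton.elim x 0]
  have hpos : ∀ x : Fin N → ℝ, x ≠ 0 → 0 < x ⬝ᵥ (S *ᵥ x) := fun x hx => by
    simpa using hS.dotProduct_mulVec_pos hx
  obtain ⟨v, hv, h⟩ := exists_min_quadratic_ratio hS Y hN
  set t := (v ⬝ᵥ (Y *ᵥ v)) / (v ⬝ᵥ (S *ᵥ v)) with ht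
  by_cases ht0 : 0 ≤ t
  · refine le_trans (mul_nonneg ht0 ?_) (h x)
    simpa using hS.posSemidef.dotProduct_mulVec_nonneg x
  have hval : ∀ w, w ⬝ᵥ ((Y - t • S) *ᵥ w) = w ⬝ᵥ (Y *ᵥ w) - t * (w ⬝ᵥ (S *ᵥ w)) := fun w => by
    simp [sub_mulVec, smul_mulVec, dotProduct_sub]
  have hZ : (Y - t • S).PosSemidef := by
    refine PosSemidef.of_dotProduct_mulVec_nonneg (hY.sub ?_) fun w => ?_
    · simp [IsHermitian, transpose_eq_of_isHermitian hS.isHermitian]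
    · rw [star_trivial, hval]; linarith [h w]
  have hZv : (Y - t • S) *ᵥ v = 0 := by
    rw [← hZ.dotProduct_mulVec_zero_iff, star_trivial, hval, ht,
      div_mul_cancel₀ _ (hpos v hv).ne', sub_self]
  have h1 := hSM v hv
  have h2 := hYM v
  rw [dotProduct_lyapunov_mulVec hS.isHermitian] at h1
  rw [dotProduct_lyapunov_mulVec hY] at h2
  have h3 : (Y *ᵥ v) ⬝ᵥ (M *ᵥ v) = t * ((S *ᵥ v) ⬝ᵥ (M *ᵥ v)) := by
    rw [sub_mulVec, sub_eq_zero, smul_mulVec] at hZv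
    rw [hZv, smul_dotProduct, smul_eq_mul]
  push Not at ht0
  nlinarith

/-- A matrix admitting a strict Lyapunov matrix is Hurwitz. -/
lemma isHurwitz_of_lyapunov {N : ℕ} {S M : Matrix (Fin N) (Fin N) ℝ} (hS : S.PosDef)
    (hSM : ∀ x : Fin N → ℝ, x ≠ 0 → x ⬝ᵥ ((Mᵀ * S + S * M) *ᵥ x) < 0) : IsHurwitz M := by
  intro μ hμ
  rw [← spectrum_toLin', ← Module.End.hasEigenvalue_iff_mem_spectrum] at hμ
  obtain ⟨z, hz⟩ := hμ.exists_hasEigenvector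
  have hz0 := hz.2
  have hzz : (M.map (algebraMap ℝ ℂ)) *ᵥ z = μ • z := by simpa using hz.apply_eq_smul
  set x : Fin N → ℝ := fun i => (z i).re with hx
  set y : Fin N → ℝ := fun i => (z i).im with hy
  have hMx : M *ᵥ x = μ.re • x - μ.im • y := by
    funext i
    have := congrArg Complex.re (congrFun hzz i)
    simpa [mulVec, dotProduct, hx, hy] using this
  have hMy : M *ᵥ y = μ.im • x + μ.re • y := by
    funext i
    have := congrArg Complex.im (congrFun hzz i)
    simp [mulVec, dotProduct] at this
    simp [mulVec, dotProduct, hx, hy, this]; ring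
  have hle : ∀ w : Fin N → ℝ, (S *ᵥ w) ⬝ᵥ (M *ᵥ w) ≤ 0 ∧ (w ≠ 0 → (S *ᵥ w) ⬝ᵥ (M *ᵥ w) < 0) := by
    intro w
    have h : w ≠ 0 → (S *ᵥ w) ⬝ᵥ (M *ᵥ w) < 0 := fun hw => by
      have := hSM w hw
      rw [dotProduct_lyapunov_mulVec hS.isHermitian] at this
      linarith
    refine ⟨?_, h⟩
    by_cases hw : w = 0
    · simp [hw]
    · exact (h hw).le
  have hsymm : (S *ᵥ x) ⬝ᵥ y = (S *ᵥ y) ⬝ᵥ x := by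
    rw [← mulVec_dotProduct_comm_of_isHermitian hS.isHermitian, dotProduct_comm]
  have hxy : x ≠ 0 ∨ y ≠ 0 := by
    by_contra! h
    apply hz0
    funext i
    exact Complex.ext (congrFun h.1 i) (congrFun h.2 i)
  have hsum : (S *ᵥ x) ⬝ᵥ (M *ᵥ x) + (S *ᵥ y) ⬝ᵥ (M *ᵥ y) =
      μ.re * (x ⬝ᵥ (S *ᵥ x) + y ⬝ᵥ (S *ᵥ y)) := by
    rw [hMx, hMy, dotProduct_comm x, dotProduct_comm y]
    simp only [dotProduct_sub, dotProduct_add, dotProduct_smul, smul_eq_mul, hsymm]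
    ring
  have hnn : ∀ w : Fin N → ℝ, 0 ≤ w ⬝ᵥ (S *ᵥ w) := fun w => by
    simpa using hS.posSemidef.dotProduct_mulVec_nonneg w
  have hneg : (S *ᵥ x) ⬝ᵥ (M *ᵥ x) + (S *ᵥ y) ⬝ᵥ (M *ᵥ y) < 0 := by
    rcases hxy with h | h
    · linarith [(hle x).2 h, (hle y).1]
    · linarith [(hle y).2 h, (hle x).1]
  rw [hsum] at hneg
  by_contra! h
  exact absurd hneg (not_lt.mpr (mul_nonneg h (add_nonneg (hnn x) (hnn y))))

end QuadraticForms

section Sylvester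

/-- The homogeneous Sylvester equation with Hurwitz coefficients has only the zero solution. -/
lemma eq_zero_of_sylvester {N : ℕ} {M₁ M₂ X : Matrix (Fin N) (Fin N) ℝ} (h₁ : IsHurwitz M₁)
    (h₂ : IsHurwitz M₂) (h : M₁ᵀ * X + X * M₂ = 0) : X = 0 := by
  classical
  set a : Matrix (Fin N) (Fin N) ℂ := -(M₁.map (algebraMap ℝ ℂ))ᵀ with ha
  set b : Matrix (Fin N) (Fin N) ℂ := M₂.map (algebraMap ℝ ℂ) with hb
  set Y : Matrix (Fin N) (Fin N) ℂ := X.map (algebraMap ℝ ℂ) with hY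
  have hint : a * Y = Y * b := by
    have h' : X * M₂ = -M₁ᵀ * X := by
      rw [neg_mul]; exact eq_neg_of_add_eq_zero_right h
    rw [hY, hb, ← Matrix.map_mul, h', Matrix.map_mul]
    congr 1
    ext i j
    simp [ha]
  have hpow : ∀ p : Polynomial ℂ, Polynomial.aeval a p * Y = Y * Polynomial.aeval b p := by
    intro p
    induction p using Polynomial.induction_on' with
    | add p q hp hq => simp [add_mul, mul_add, hp, hq]
    | monomial k c =>
      have hk : ∀ k : ℕ, a ^ k * Y = Y * b ^ k := fun k => by
        induction k with
        | zero => simp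
        | succ k ih => rw [pow_succ, mul_assoc, hint, ← mul_assoc, ih, mul_assoc, ← pow_succ]
      simp only [Polynomial.aeval_monomial, Algebra.algebraMap_eq_smul_one, smul_mul_assoc,
        one_mul, mul_smul_comm, hk k]
  have hzero : Polynomial.aeval a b.charpoly * Y = 0 := by
    rw [hpow, aeval_self_charpoly, mul_zero]
  have hunit : IsUnit (Polynomial.aeval a b.charpoly) := by
    by_contra hnot
    rcases isEmpty_or_nonempty (Fin N) with hN | hN
    · exact hnot (by rw [Subsingleton.elim (Polynomial.aeval a b.charpoly) 1]; exact isUnit_one)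
    have hspec : (0 : ℂ) ∈ spectrum ℂ (Polynomial.aeval a b.charpoly) :=
      spectrum.zero_mem_iff ℂ |>.mpr hnot
    rw [spectrum.map_polynomial_aeval_of_nonempty a _
      (spectrum.nonempty_of_isAlgClosed_of_finiteDimensional ℂ a)] at hspec
    obtain ⟨ν, hν, hroot⟩ := hspec
    have hν₂ : ν ∈ spectrum ℂ b := by
      rw [Matrix.mem_spectrum_iff_isRoot_charpoly]; exact hroot
    have hν₁ : -ν ∈ spectrum ℂ (M₁.map (algebraMap ℝ ℂ)) := by
      rw [ha, ← spectrum.neg_eq, Set.mem_neg] at hν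
      rw [Matrix.mem_spectrum_iff_isRoot_charpoly] at hν ⊢
      rwa [charpoly_transpose] at hν
    have := h₁ _ hν₁
    have := h₂ _ hν₂
    simp only [Complex.neg_re] at *
    linarith
  have hY0 : Y = 0 := by
    obtain ⟨u, hu⟩ := hunit
    rw [← hu] at hzero
    simpa using hzero
  ext i j
  have := congrFun (congrFun hY0 i) j
  simpa [hY] using this

end Sylvester

section Frobenius

open scoped Matrix.Norms.Frobenius

lemma trace_transpose_mul_eq_sum {p q : ℕ} (X Y : Matrix (Fin p) (Fin q) ℝ) :
    Matrix.trace (Xᵀ * Y) = ∑ i, ∑ j, X i j * Y i j := by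
  rw [Finset.sum_comm]
  simp [trace, mul_apply]

lemma trace_transpose_mul_self_eq_sum {p q : ℕ} (M : Matrix (Fin p) (Fin q) ℝ) :
    Matrix.trace (Mᵀ * M) = ∑ i, ∑ j, M i j ^ 2 := by
  simp_rw [trace_transpose_mul_eq_sum, sq]

lemma frobNorm_eq_norm {p q : ℕ} (M : Matrix (Fin p) (Fin q) ℝ) : frobNorm M = ‖M‖ := by
  rw [frobNorm, trace_transpose_mul_self_eq_sum, frobenius_norm_def, Real.sqrt_eq_rpow]
  simp

lemma norm_sq_eq_trace {p q : ℕ} (M : Matrix (Fin p) (Fin q) ℝ) :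
    ‖M‖ ^ 2 = Matrix.trace (Mᵀ * M) := by
  rw [← frobNorm_eq_norm, frobNorm, Real.sq_sqrt]
  rw [trace_transpose_mul_self_eq_sum]
  positivity

lemma trace_transpose_mul_le {p q : ℕ} (X Y : Matrix (Fin p) (Fin q) ℝ) :
    Matrix.trace (Xᵀ * Y) ≤ ‖X‖ * ‖Y‖ := by
  have hsum : Matrix.trace (Xᵀ * Y) = ∑ ij : Fin p × Fin q, X ij.1 ij.2 * Y ij.1 ij.2 := by
    rw [Fintype.sum_prod_type, trace_transpose_mul_eq_sum]
  have hsq : ∀ Z : Matrix (Fin p) (Fin q) ℝ, ‖Z‖ ^ 2 = ∑ ij : Fin p × Fin q, Z ij.1 ij.2 ^ 2 :=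
    fun Z => by rw [norm_sq_eq_trace, trace_transpose_mul_self_eq_sum, Fintype.sum_prod_type]
  refine le_of_abs_le (abs_le_of_sq_le_sq ?_ (by positivity))
  rw [mul_pow, hsum, hsq, hsq]
  exact Finset.sum_mul_sq_le_sq_mul_sq _ _ _

lemma abs_quadratic_le {N : ℕ} (M : Matrix (Fin N) (Fin N) ℝ) (x : Fin N → ℝ) :
    |x ⬝ᵥ (M *ᵥ x)| ≤ ‖M‖ * (x ⬝ᵥ x) := by
  set V : Matrix (Fin N) (Fin 1) ℝ := replicateCol (Fin 1) x with hV
  have h1 : ∀ M : Matrix (Fin N) (Fin N) ℝ, x ⬝ᵥ (M *ᵥ x) = Matrix.trace (Vᵀ * (M * V)) := by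
    intro M
    simp [hV, trace, mul_apply, dotProduct, mulVec]
  have h2 : x ⬝ᵥ x = ‖V‖ ^ 2 := by
    simpa [norm_sq_eq_trace] using h1 1
  have h3 : ∀ M : Matrix (Fin N) (Fin N) ℝ, x ⬝ᵥ (M *ᵥ x) ≤ ‖M‖ * (x ⬝ᵥ x) := fun M => by
    rw [h1, h2]
    calc _ ≤ ‖V‖ * ‖M * V‖ := trace_transpose_mul_le _ _
      _ ≤ ‖V‖ * (‖M‖ * ‖V‖) := by gcongr; exact frobenius_norm_mul _ _
      _ = _ := by ring
  refine abs_le.mpr ⟨?_, h3 M⟩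
  have := h3 (-M)
  rw [neg_mulVec, dotProduct_neg, norm_neg] at this
  linarith

lemma trace_diagonalized {m q : ℕ} {M : Matrix (Fin m) (Fin m) ℝ} (hM : M.IsHermitian) :
    ∀ X : Matrix (Fin m) (Fin q) ℝ, ∃ Y : Matrix (Fin m) (Fin q) ℝ,
      Matrix.trace (Xᵀ * X) = ∑ i, ∑ j, Y i j ^ 2 ∧
      Matrix.trace (Xᵀ * (M * X)) = ∑ i, ∑ j, hM.eigenvalues i * Y i j ^ 2 ∧
      Matrix.trace ((M * X)ᵀ * (M * X)) = ∑ i, ∑ j, hM.eigenvalues i ^ 2 * Y i j ^ 2 := by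
  intro X
  set U : Matrix (Fin m) (Fin m) ℝ := (hM.eigenvectorUnitary : Matrix (Fin m) (Fin m) ℝ) with hU
  have hUU : U * Uᵀ = 1 := by
    have := Unitary.coe_mul_star_self hM.eigenvectorUnitary
    simpa [star_eq_conjTranspose, conjTranspose_eq_transpose_of_trivial] using this
  have hUU' : Uᵀ * U = 1 := by
    have := Unitary.coe_star_mul_self hM.eigenvectorUnitary
    simpa [star_eq_conjTranspose, conjTranspose_eq_transpose_of_trivial] using this
  have hspec : M = U * diagonal hM.eigenvalues * Uᵀ := by
    have := hM.spectral_theorem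
    rw [Unitary.conjStarAlgAut_apply] at this
    simpa [star_eq_conjTranspose, conjTranspose_eq_transpose_of_trivial, Function.comp_def]
      using this
  generalize hM.eigenvalues = d at *
  have hX : X = U * (Uᵀ * X) := by rw [← Matrix.mul_assoc, hUU, Matrix.one_mul]
  generalize Uᵀ * X = Y at hX
  have hMX : M * X = U * (diagonal d * Y) := by
    rw [hspec, hX]; simp only [Matrix.mul_assoc]
    rw [← Matrix.mul_assoc Uᵀ, hUU', Matrix.one_mul]
  have hcancel : ∀ Z W : Matrix (Fin m) (Fin q) ℝ, (U * Z)ᵀ * (U * W) = Zᵀ * W := fun Z W => by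
    rw [transpose_mul, Matrix.mul_assoc, ← Matrix.mul_assoc Uᵀ, hUU', Matrix.one_mul]
  refine ⟨Y, ?_, ?_, ?_⟩
  · rw [hX, hcancel, trace_transpose_mul_self_eq_sum]
  · rw [hMX, hX, hcancel, trace_transpose_mul_eq_sum]
    simp only [diagonal_mul]
    exact Finset.sum_congr rfl fun _ _ => Finset.sum_congr rfl fun _ _ => by ring
  · rw [hMX, hcancel, trace_transpose_mul_self_eq_sum]
    simp only [diagonal_mul, mul_pow]

lemma eigMin_mul_norm_sq_le {m q : ℕ} {M : Matrix (Fin m) (Fin m) ℝ} (hM : M.IsHermitian)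
    (X : Matrix (Fin m) (Fin q) ℝ) :
    eigMin M * ‖X‖ ^ 2 ≤ Matrix.trace (Xᵀ * (M * X)) := by
  obtain ⟨Y, h1, h2, -⟩ := trace_diagonalized hM X
  rw [norm_sq_eq_trace, h1, h2, eigMin, dif_pos hM, Finset.mul_sum]
  refine Finset.sum_le_sum fun i _ => ?_
  rw [Finset.mul_sum]
  refine Finset.sum_le_sum fun j _ => ?_
  gcongr
  exact ciInf_le (Set.finite_range _).bddBelow i

lemma norm_mul_sq_le_eigMax_sq {m q : ℕ} {M : Matrix (Fin m) (Fin m) ℝ} (hM : M.PosSemidef)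
    (X : Matrix (Fin m) (Fin q) ℝ) :
    ‖M * X‖ ^ 2 ≤ eigMax M ^ 2 * ‖X‖ ^ 2 := by
  obtain ⟨Y, h1, -, h3⟩ := trace_diagonalized hM.isHermitian X
  rw [norm_sq_eq_trace, norm_sq_eq_trace, h1, h3, eigMax, dif_pos hM.isHermitian, Finset.mul_sum]
  refine Finset.sum_le_sum fun i _ => ?_
  rw [Finset.mul_sum]
  refine Finset.sum_le_sum fun j _ => ?_
  gcongr
  · exact hM.eigenvalues_nonneg i
  · exact le_ciSup (Set.finite_range hM.isHermitian.eigenvalues).bddAbove i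

lemma norm_le_of_quadratic_le {N : ℕ} {P T : Matrix (Fin N) (Fin N) ℝ} (hP : P.PosSemidef)
    (hPT : ∀ x : Fin N → ℝ, x ⬝ᵥ (P *ᵥ x) ≤ x ⬝ᵥ (T *ᵥ x)) :
    ‖P‖ ^ 2 ≤ ∑ i : Fin N, ∑ j : Fin N, (|T i i| + |T j j|) ^ 2 := by
  rw [norm_sq_eq_trace, trace_transpose_mul_self_eq_sum]
  refine Finset.sum_le_sum fun i _ => Finset.sum_le_sum fun j _ => sq_le_sq' ?_ ?_
  all_goals
    have hsymm : P j i = P i j := by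
      simpa using congrFun (congrFun (transpose_eq_of_isHermitian hP.isHermitian) i) j
    have hdiag : ∀ k, P k k ≤ |T k k| := fun k => by
      have := hPT (Pi.single k 1)
      simp at this
      exact this.trans (le_abs_self _)
    have hplus := hP.dotProduct_mulVec_nonneg (Pi.single i 1 + Pi.single j 1)
    have hminus := hP.dotProduct_mulVec_nonneg (Pi.single i 1 - Pi.single j 1)
    have hi := hP.diag_nonneg (i := i)
    have hj := hP.diag_nonneg (i := j)
    simp [mulVec_add, mulVec_sub, add_dotProduct, sub_dotProduct] at hplus hminus
    have := hdiag i
    have := hdiag j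
    linarith

end Frobenius

section Riccati

open scoped Matrix.Norms.Frobenius

lemma eventually_posDef {N : ℕ} {α : Type*} {l : Filter α} {f : α → Matrix (Fin N) (Fin N) ℝ}
    {M : Matrix (Fin N) (Fin N) ℝ} (hf : Tendsto f l (𝓝 M)) (hM : M.PosDef)
    (hsymm : ∀ᶠ t in l, (f t).IsHermitian) : ∀ᶠ t in l, (f t).PosDef := by
  obtain ⟨δ, hδ, hlow⟩ := exists_quadratic_lower_bound hM
  filter_upwards [hsymm, Metric.tendsto_nhds.mp hf δ hδ] with t ht hdist
  refine PosDef.of_dotProduct_mulVec_pos ht fun x hx => ?_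
  have hxx : 0 < x ⬝ᵥ x := by
    simpa using (PosDef.one (n := Fin N) (R := ℝ)).dotProduct_mulVec_pos hx
  have h1 := (abs_le.mp (abs_quadratic_le (f t - M) x)).1
  have h2 := hlow x
  rw [sub_mulVec, dotProduct_sub] at h1
  rw [dist_eq_norm] at hdist
  have h3 := mul_lt_mul_of_pos_right hdist hxx
  rw [star_trivial]
  linarith

lemma hasDerivAt_entry {p q : ℕ} {f : ℝ → Matrix (Fin p) (Fin q) ℝ}
    {f' : Matrix (Fin p) (Fin q) ℝ} {t : ℝ} (hf : HasDerivAt f f' t) (i : Fin p) (j : Fin q) :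
    HasDerivAt (fun s => f s i j) (f' i j) t :=
  ((entryLinearMap ℝ ℝ i j).toContinuousLinearMap.hasFDerivAt.comp_hasDerivAt t hf)

/-- The implicit function theorem for the Riccati equation: a solution with nonsingular
linearization extends to a differentiable branch of symmetric solutions. -/
lemma exists_riccati_branch {N : ℕ} {A₀ E Q B P : Matrix (Fin N) (Fin N) ℝ} (hQ : Qᵀ = Q)
    (hB : Bᵀ = B) (hP : Pᵀ = P) (heq : A₀ᵀ * P + P * A₀ + Q + P * B * P = 0)
    (hinj : ∀ H, (A₀ + B * P)ᵀ * H + H * (A₀ + B * P) = 0 → H = 0) :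
    ∃ (p : ℝ → Matrix (Fin N) (Fin N) ℝ) (p' : Matrix (Fin N) (Fin N) ℝ),
      p 0 = P ∧ HasDerivAt p p' 0 ∧
      (∀ᶠ t in 𝓝 (0 : ℝ), (A₀ + t • E)ᵀ * p t + p t * (A₀ + t • E) + Q + p t * B * p t = 0) ∧
      ∀ᶠ t in 𝓝 (0 : ℝ), (p t)ᵀ = p t := by
  set F : ℝ × Matrix (Fin N) (Fin N) ℝ → Matrix (Fin N) (Fin N) ℝ := fun u =>
    (A₀ᵀ + u.1 • Eᵀ) * u.2 + u.2 * (A₀ + u.1 • E) + Q + u.2 * B * u.2 with hF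
  have hF0 : F (0, P) = 0 := by simpa [hF] using heq
  have hsmooth : ContDiff ℝ 1 F := by fun_prop
  have hstrict : HasStrictFDerivAt F (fderiv ℝ F (0, P)) (0, P) :=
    hsmooth.contDiffAt.hasStrictFDerivAt one_ne_zero
  set G : Matrix (Fin N) (Fin N) ℝ →L[ℝ] Matrix (Fin N) (Fin N) ℝ :=
    (fderiv ℝ F (0, P)) ∘L .inr ℝ ℝ (Matrix (Fin N) (Fin N) ℝ) with hG
  have hl : ∀ H : Matrix (Fin N) (Fin N) ℝ, HasDerivAt (fun s : ℝ => P + s • H) H 0 := by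
    intro H
    have := ((hasDerivAt_id (0 : ℝ)).smul_const H).const_add P
    rw [one_smul] at this
    exact this
  have hGapply : ∀ H, G H = (A₀ + B * P)ᵀ * H + H * (A₀ + B * P) := by
    intro H
    have h1 : HasDerivAt (fun s : ℝ => F (0, P + s • H)) (G H) 0 := by
      have hline : HasDerivAt (fun s : ℝ => ((0 : ℝ), P + s • H)) ((0 : ℝ), H) 0 :=
        (hasDerivAt_const _ _).prodMk (hl H)
      have hstr : HasFDerivAt F (fderiv ℝ F (0, P)) (0, P + (0 : ℝ) • H) := by
        simpa using hstrict.hasFDerivAt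
      exact hstr.comp_hasDerivAt (0 : ℝ) hline
    have h2 : HasDerivAt (fun s : ℝ => F (0, P + s • H))
        ((A₀ + B * P)ᵀ * H + H * (A₀ + B * P)) 0 := by
      have := (((((hl H).const_mul A₀ᵀ).add ((hl H).mul_const A₀)).add_const Q).add
        (((hl H).mul_const B).mul (hl H)))
      refine (this.congr_deriv ?_).congr_of_eventuallyEq ?_
      · simp only [zero_smul, add_zero, transpose_add, transpose_mul, hP, hB]
        noncomm_ring
      · filter_upwards with s
        simp [hF]
    exact h1.unique h2
  have hGinv : G.IsInvertible := by
    have hGinj : Function.Injective G.toLinearMap :=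
      (injective_iff_map_eq_zero _).mpr fun H hH => hinj H (by rw [← hGapply]; exact hH)
    exact ⟨(LinearEquiv.ofInjectiveEndo G.toLinearMap hGinj).toContinuousLinearEquiv, by
      ext1 H; rfl⟩
  have hp0 : hstrict.implicitFunctionOfProdDomain hGinv 0 = P :=
    (hstrict.eventually_apply_eq_iff_implicitFunctionOfProdDomain hGinv).self_of_nhds.mp rfl
  have hdiff := (hstrict.hasStrictFDerivAt_implicitFunctionOfProdDomain hGinv).hasFDerivAt
  have hsol := hstrict.eventually_apply_implicitFunctionOfProdDomain hGinv
  have huniq := hstrict.eventually_apply_eq_iff_implicitFunctionOfProdDomain hGinv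
  generalize hstrict.implicitFunctionOfProdDomain hGinv = p at *
  rw [hF0] at hsol huniq
  have hd := hdiff.hasDerivAt
  refine ⟨p, _, hp0, hd, ?_, ?_⟩
  · filter_upwards [hsol] with t ht
    simpa [hF] using ht
  · have hcont : Tendsto (fun t : ℝ => (t, (p t)ᵀ)) (𝓝 0) (𝓝 (0, P)) := by
      have h1 : Tendsto (fun t => (p t)ᵀ) (𝓝 (0 : ℝ)) (𝓝 (p 0)ᵀ) :=
        (continuous_id.matrix_transpose.tendsto (p 0)).comp hd.continuousAt
      rw [hp0, hP] at h1
      exact tendsto_id.prodMk_nhds h1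
    filter_upwards [hsol, hcont.eventually huniq] with t ht hiff
    refine (hiff.mp ?_).symm
    have := congrArg transpose ht
    simp only [hF, transpose_add, transpose_mul, hQ, hB, transpose_smul, transpose_transpose,
      transpose_zero] at this ⊢
    rw [← this]
    noncomm_ring

lemma deriv_riccati_branch {N : ℕ} {A₀ E Q B P p' : Matrix (Fin N) (Fin N) ℝ}
    {p : ℝ → Matrix (Fin N) (Fin N) ℝ} (hB : Bᵀ = B) (hP : Pᵀ = P) (hp0 : p 0 = P)
    (hp : HasDerivAt p p' 0)
    (hsol : ∀ᶠ t in 𝓝 (0 : ℝ),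
      (A₀ + t • E)ᵀ * p t + p t * (A₀ + t • E) + Q + p t * B * p t = 0) :
    (A₀ + B * P)ᵀ * p' + p' * (A₀ + B * P) + (Eᵀ * P + P * E) = 0 := by
  have hl : ∀ X Y : Matrix (Fin N) (Fin N) ℝ, HasDerivAt (fun s : ℝ => X + s • Y) Y 0 := by
    intro X Y
    have := ((hasDerivAt_id (0 : ℝ)).smul_const Y).const_add X
    rw [one_smul] at this
    exact this
  have h1 := ((((hl A₀ᵀ Eᵀ).mul hp).add (hp.mul (hl A₀ E))).add_const Q).add
    ((hp.mul_const B).mul hp)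
  have h2 := (hasDerivAt_const (0 : ℝ) (0 : Matrix (Fin N) (Fin N) ℝ)).congr_of_eventuallyEq
    (f₁ := fun t => (A₀ᵀ + t • Eᵀ) * p t + p t * (A₀ + t • E) + Q + p t * B * p t) (by
      filter_upwards [hsol] with t ht
      simpa using ht)
  have h3 := h1.unique h2
  rw [hp0, zero_smul, add_zero, zero_smul, add_zero] at h3
  rw [← h3, transpose_add, transpose_mul, hP, hB]
  noncomm_ring

/-- The derivative of the cost through the Riccati solution, expressed by the adjoint Lyapunov
equation. -/
lemma trace_adjoint_identity {N k : ℕ} {M H Pim P E : Matrix (Fin N) (Fin N) ℝ}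
    {X C : Matrix (Fin k) (Fin N) ℝ} (hP : Pᵀ = P) (hPim : Pimᵀ = Pim) (hH : Hᵀ = H)
    (h₁ : Mᵀ * H + H * M + (Eᵀ * P + P * E) = 0)
    (h₂ : M * Pim + Pim * Mᵀ + (Xᵀ * C + Cᵀ * X) = 0) :
    trace (Xᵀ * (C * H)) = trace (Pim * P * E) := by
  have a1 := congrArg (fun Z => trace (Pim * Z)) h₁
  have a2 := congrArg (fun Z => trace (Z * H)) h₂
  simp only [Matrix.mul_add, Matrix.add_mul, trace_add, Matrix.mul_zero, Matrix.zero_mul,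
    trace_zero, ← Matrix.mul_assoc] at a1 a2 ⊢
  have e1 : trace (Pim * Eᵀ * P) = trace (Pim * P * E) := by
    rw [← trace_transpose]
    simp only [transpose_mul, transpose_transpose, hP, hPim]
    rw [trace_mul_comm, Matrix.mul_assoc, trace_mul_comm]
  have e2 : trace (Cᵀ * X * H) = trace (Xᵀ * C * H) := by
    rw [← trace_transpose]
    simp only [transpose_mul, transpose_transpose, hH]
    rw [trace_mul_comm]
  have e3 : trace (M * Pim * H) = trace (Pim * H * M) := by
    rw [Matrix.mul_assoc, trace_mul_comm]
  linarith

lemma hasDerivAt_frobNorm_sq {p q : ℕ} {f : ℝ → Matrix (Fin p) (Fin q) ℝ}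
    {f' : Matrix (Fin p) (Fin q) ℝ} {t : ℝ} (hf : HasDerivAt f f' t) :
    HasDerivAt (fun s => frobNorm (f s) ^ 2) (2 * trace ((f t)ᵀ * f')) t := by
  simp_rw [frobNorm_eq_norm, norm_sq_eq_trace, trace_transpose_mul_self_eq_sum,
    trace_transpose_mul_eq_sum, Finset.mul_sum]
  refine HasDerivAt.fun_sum fun i _ => HasDerivAt.fun_sum fun j _ => ?_
  exact ((hasDerivAt_entry hf i j).fun_pow 2).congr_deriv (by simp [mul_assoc])

lemma hasDerivAt_trace_quadratic {p q : ℕ} {Γ : Matrix (Fin p) (Fin p) ℝ} (hΓ : Γᵀ = Γ)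
    (Λ D : Matrix (Fin p) (Fin q) ℝ) :
    HasDerivAt (fun t : ℝ => trace ((Λ + t • D)ᵀ * Γ * (Λ + t • D)))
      (2 * trace ((Γ * Λ)ᵀ * D)) 0 := by
  have hexp : ∀ t : ℝ, trace ((Λ + t • D)ᵀ * Γ * (Λ + t • D)) =
      trace (Λᵀ * Γ * Λ) + t * (2 * trace ((Γ * Λ)ᵀ * D)) + t ^ 2 * trace (Dᵀ * Γ * D) := by
    intro t
    have h : trace (Dᵀ * Γ * Λ) = trace (Λᵀ * Γ * D) := by
      rw [← trace_transpose]
      simp only [transpose_mul, transpose_transpose, hΓ, Matrix.mul_assoc]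
    simp only [transpose_add, transpose_smul, transpose_mul, Matrix.add_mul, Matrix.mul_add,
      trace_add, Matrix.smul_mul, Matrix.mul_smul, trace_smul, smul_eq_mul, hΓ, h]
    ring
  simp_rw [hexp]
  have := (((hasDerivAt_id (0 : ℝ)).mul_const (2 * trace ((Γ * Λ)ᵀ * D))).const_add
    (trace (Λᵀ * Γ * Λ))).add (((hasDerivAt_id (0 : ℝ)).pow 2).mul_const (trace (Dᵀ * Γ * D)))
  exact this.congr_deriv (by simp)

end Riccati

section SpoofedARE

variable {A : Matrix (Fin n) (Fin n) ℝ} {Bu : Matrix (Fin n) (Fin m_u) ℝ}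
  {Ba : Matrix (Fin n) (Fin m_a) ℝ} {Q : Matrix (Fin n) (Fin n) ℝ}
  {R : Matrix (Fin m_a) (Fin m_a) ℝ}

lemma transpose_input_weight (hR : R.PosDef) : (Ba * R⁻¹ * Baᵀ)ᵀ = Ba * R⁻¹ * Baᵀ := by
  simp only [transpose_mul, transpose_transpose, transpose_eq_of_isHermitian hR.inv.isHermitian,
    Matrix.mul_assoc]

/-- The stabilizing solution of the spoofed ARE is unique. -/
lemma IsStabSol.unique (hR : R.PosDef) {Λ : Matrix (Fin m_u) (Fin n) ℝ}
    {P₁ P₂ : Matrix (Fin n) (Fin n) ℝ} (h₁ : IsStabSol A Bu Ba Q R Λ P₁)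
    (h₂ : IsStabSol A Bu Ba Q R Λ P₂) : P₁ = P₂ := by
  refine sub_eq_zero.mp (eq_zero_of_sylvester h₁.2.2 h₂.2.2 ?_)
  have e := (h₁.2.1.trans h₂.2.1.symm)
  rw [← sub_eq_zero] at e
  rw [transpose_add, transpose_mul, transpose_input_weight hR,
    transpose_eq_of_isHermitian h₁.1.isHermitian, ← e]
  simp only [Matrix.mul_assoc, Matrix.add_mul, Matrix.mul_add, Matrix.mul_sub, Matrix.sub_mul]
  abel

lemma closedLoop_lyapunov_eq (hR : R.PosDef) {Λ : Matrix (Fin m_u) (Fin n) ℝ}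
    {P : Matrix (Fin n) (Fin n) ℝ} (hPT : Pᵀ = P)
    (h : (A + Bu * Λ)ᵀ * P + P * (A + Bu * Λ) + Q + P * Ba * R⁻¹ * Baᵀ * P = 0) :
    (A + Bu * Λ + Ba * R⁻¹ * Baᵀ * P)ᵀ * P + P * (A + Bu * Λ + Ba * R⁻¹ * Baᵀ * P) =
      (Baᵀ * P)ᵀ * R⁻¹ * (Baᵀ * P) - Q := by
  rw [transpose_add, transpose_mul (Ba * R⁻¹ * Baᵀ), transpose_input_weight hR, hPT,
    ← sub_eq_zero, ← h]
  simp only [transpose_mul, transpose_transpose, hPT, Matrix.add_mul, Matrix.mul_add,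
    Matrix.mul_assoc]
  abel

/-- Limits of stabilizing solutions over the sublevel set are stabilizing when a single Lyapunov
matrix certifies all closed loops. -/
lemma mem_S0_of_tendsto (hQ : Q.PosDef) (hR : R.PosDef) {Γ : Matrix (Fin m_u) (Fin m_u) ℝ}
    {Kbar : Matrix (Fin m_a) (Fin n) ℝ}
    {Pu : Matrix (Fin m_u) (Fin n) ℝ → Matrix (Fin n) (Fin n) ℝ}
    (hPu : ∀ Λ, (∃ P, IsStabSol A Bu Ba Q R Λ P) → IsStabSol A Bu Ba Q R Λ (Pu Λ))
    {S : Matrix (Fin n) (Fin n) ℝ} (hS : S.PosDef) {δ : ℝ} (hδ : 0 < δ)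
    (hSM : ∀ Λ ∈ S0 A Bu Ba Q R Γ Kbar Pu, ∀ x : Fin n → ℝ,
      x ⬝ᵥ (((A + Bu * Λ + Ba * R⁻¹ * Baᵀ * Pu Λ)ᵀ * S +
        S * (A + Bu * Λ + Ba * R⁻¹ * Baᵀ * Pu Λ)) *ᵥ x) ≤ -δ * (x ⬝ᵥ x))
    {u : ℕ → Matrix (Fin m_u) (Fin n) ℝ} {Λ : Matrix (Fin m_u) (Fin n) ℝ}
    {P : Matrix (Fin n) (Fin n) ℝ} (hu : ∀ k, u k ∈ S0 A Bu Ba Q R Γ Kbar Pu)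
    (hlim : Tendsto u atTop (𝓝 Λ)) (hP : Tendsto (fun k => Pu (u k)) atTop (𝓝 P)) :
    Λ ∈ S0 A Bu Ba Q R Γ Kbar Pu := by
  have hstab : ∀ k, IsStabSol A Bu Ba Q R (u k) (Pu (u k)) := fun k => hPu _ (hu k).1
  have hpair := hlim.prodMk_nhds hP
  have hPT : Pᵀ = P := by
    have hc : IsClosed {X : Matrix (Fin n) (Fin n) ℝ | Xᵀ = X} :=
      isClosed_eq (by fun_prop) (by fun_prop)
    exact hc.mem_of_tendsto hP (Eventually.of_forall fun k =>
      transpose_eq_of_isHermitian (hstab k).1.isHermitian)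
  have hPnn : ∀ x : Fin n → ℝ, 0 ≤ x ⬝ᵥ (P *ᵥ x) := fun x => by
    have hc : IsClosed {X : Matrix (Fin n) (Fin n) ℝ | 0 ≤ x ⬝ᵥ (X *ᵥ x)} :=
      isClosed_le (by fun_prop) (by fun_prop)
    exact hc.mem_of_tendsto hP (Eventually.of_forall fun k => by
      simpa using (hstab k).1.posSemidef.dotProduct_mulVec_nonneg x)
  have hARE : (A + Bu * Λ)ᵀ * P + P * (A + Bu * Λ) + Q + P * Ba * R⁻¹ * Baᵀ * P = 0 := by
    have hc : Continuous fun z : Matrix (Fin m_u) (Fin n) ℝ × Matrix (Fin n) (Fin n) ℝ =>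
        (A + Bu * z.1)ᵀ * z.2 + z.2 * (A + Bu * z.1) + Q + z.2 * Ba * R⁻¹ * Baᵀ * z.2 := by
      fun_prop
    have ht := (hc.tendsto (Λ, P)).comp hpair
    have hz : ∀ k, ((fun z : Matrix (Fin m_u) (Fin n) ℝ × Matrix (Fin n) (Fin n) ℝ =>
        (A + Bu * z.1)ᵀ * z.2 + z.2 * (A + Bu * z.1) + Q + z.2 * Ba * R⁻¹ * Baᵀ * z.2) ∘
        fun k => (u k, Pu (u k))) k = 0 := fun k => (hstab k).2.1
    exact tendsto_nhds_unique ht (tendsto_const_nhds.congr fun k => (hz k).symm)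
  have hlyap : ∀ x : Fin n → ℝ, x ⬝ᵥ (((A + Bu * Λ + Ba * R⁻¹ * Baᵀ * P)ᵀ * S +
      S * (A + Bu * Λ + Ba * R⁻¹ * Baᵀ * P)) *ᵥ x) ≤ -δ * (x ⬝ᵥ x) := fun x => by
    have hc : Continuous fun z : Matrix (Fin m_u) (Fin n) ℝ × Matrix (Fin n) (Fin n) ℝ =>
        x ⬝ᵥ (((A + Bu * z.1 + Ba * R⁻¹ * Baᵀ * z.2)ᵀ * S +
          S * (A + Bu * z.1 + Ba * R⁻¹ * Baᵀ * z.2)) *ᵥ x) := by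
      fun_prop
    have ht := (hc.tendsto (Λ, P)).comp hpair
    exact le_of_tendsto' ht fun k => hSM (u k) (hu k) x
  have hcost : frobNorm (R⁻¹ * Baᵀ * P - Kbar) ^ 2 + trace (Λᵀ * Γ * Λ) ≤
      Jcost Ba R Γ Kbar Pu 0 := by
    have hc : Continuous fun z : Matrix (Fin m_u) (Fin n) ℝ × Matrix (Fin n) (Fin n) ℝ =>
        frobNorm (R⁻¹ * Baᵀ * z.2 - Kbar) ^ 2 + trace (z.1ᵀ * Γ * z.1) := by
      simp only [frobNorm]
      fun_prop
    have ht := (hc.tendsto (Λ, P)).comp hpair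
    exact le_of_tendsto' ht fun k => (hu k).2
  have hPpsd : P.PosSemidef := PosSemidef.of_dotProduct_mulVec_nonneg
    (by simpa [IsHermitian] using hPT) (by simpa using hPnn)
  have hsol : IsStabSol A Bu Ba Q R Λ P := by
    refine ⟨PosDef.of_dotProduct_mulVec_pos hPpsd.isHermitian fun x hx => ?_, hARE,
      isHurwitz_of_lyapunov hS fun x hx => ?_⟩
    · refine lt_of_le_of_ne (by simpa using hPnn x) fun h0 => ?_
      have hPx : P *ᵥ x = 0 := (hPpsd.dotProduct_mulVec_zero_iff x).mp h0.symm
      have hl := congrArg (fun X => x ⬝ᵥ (X *ᵥ x)) (closedLoop_lyapunov_eq hR hPT hARE)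
      simp only [dotProduct_lyapunov_mulVec hPpsd.isHermitian, hPx, zero_dotProduct, mul_zero,
        sub_mulVec, ← mulVec_mulVec, mulVec_zero, dotProduct_sub, dotProduct_zero] at hl
      have := hQ.dotProduct_mulVec_pos hx
      rw [star_trivial] at this
      linarith
    · have hxx : 0 < x ⬝ᵥ x := by
        simpa using (PosDef.one (n := Fin n) (R := ℝ)).dotProduct_mulVec_pos hx
      nlinarith [hlyap x]
  refine ⟨⟨P, hsol⟩, ?_⟩
  rw [Jcost, IsStabSol.unique hR (hPu _ ⟨P, hsol⟩) hsol]
  exact hcost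

open scoped Matrix.Norms.Frobenius

/-- Along a line through a gain whose closed loop is certified by the Lyapunov matrix `S`, the
stabilizing solution extends differentiably. -/
lemma exists_stabSol_branch (hQ : Q.PosDef) (hR : R.PosDef) {Λ : Matrix (Fin m_u) (Fin n) ℝ}
    {P S : Matrix (Fin n) (Fin n) ℝ} (hP : IsStabSol A Bu Ba Q R Λ P) (hS : S.PosDef)
    (hSM : ∀ x : Fin n → ℝ, x ≠ 0 → x ⬝ᵥ (((A + Bu * Λ + Ba * R⁻¹ * Baᵀ * P)ᵀ * S +
      S * (A + Bu * Λ + Ba * R⁻¹ * Baᵀ * P)) *ᵥ x) < 0)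
    (D : Matrix (Fin m_u) (Fin n) ℝ) :
    ∃ (p : ℝ → Matrix (Fin n) (Fin n) ℝ) (p' : Matrix (Fin n) (Fin n) ℝ),
      p 0 = P ∧ HasDerivAt p p' 0 ∧ p'ᵀ = p' ∧
      (∀ᶠ t in 𝓝 (0 : ℝ), IsStabSol A Bu Ba Q R (Λ + t • D) (p t)) ∧
      (A + Bu * Λ + Ba * R⁻¹ * Baᵀ * P)ᵀ * p' + p' * (A + Bu * Λ + Ba * R⁻¹ * Baᵀ * P) +
        ((Bu * D)ᵀ * P + P * (Bu * D)) = 0 := by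
  have hB := transpose_input_weight (Ba := Ba) hR
  have hPT := transpose_eq_of_isHermitian hP.1.isHermitian
  have hQT := transpose_eq_of_isHermitian hQ.isHermitian
  have hST := transpose_eq_of_isHermitian hS.isHermitian
  have heq := hP.2.1
  have hHur := hP.2.2
  have hassoc : ∀ X : Matrix (Fin n) (Fin n) ℝ, X * Ba * R⁻¹ * Baᵀ * X =
      X * (Ba * R⁻¹ * Baᵀ) * X := fun X => by
    simp only [Matrix.mul_assoc]
  rw [hassoc] at heq
  obtain ⟨p, p', hp0, hp, hsol, hsymm⟩ := exists_riccati_branch (E := Bu * D) hQT hB hPT heq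
    (fun H hH => eq_zero_of_sylvester hHur hHur hH)
  have hderiv := deriv_riccati_branch hB hPT hp0 hp hsol
  have hp't : p'ᵀ = p' := by
    refine (sub_eq_zero.mp (eq_zero_of_sylvester hHur hHur (X := p'ᵀ - p') ?_))
    have ht := congrArg transpose hderiv
    simp only [transpose_add, transpose_mul, transpose_transpose, hPT, transpose_zero]
      at ht hderiv ⊢
    have := ht.trans hderiv.symm
    rw [← sub_eq_zero] at this
    rw [← this]
    noncomm_ring
  refine ⟨p, p', hp0, hp, hp't, ?_, hderiv⟩
  have hpc : Tendsto p (𝓝 0) (𝓝 P) := hp0 ▸ hp.continuousAt.tendsto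
  have hposdef := eventually_posDef hpc hP.1 (hsymm.mono fun t ht => by
    simpa [IsHermitian] using ht)
  set M : ℝ → Matrix (Fin n) (Fin n) ℝ :=
    fun t => A + Bu * (Λ + t • D) + Ba * R⁻¹ * Baᵀ * p t with hM
  have hMc : Tendsto M (𝓝 0) (𝓝 (A + Bu * Λ + Ba * R⁻¹ * Baᵀ * P)) := by
    have h1 : Tendsto (fun t : ℝ => A + Bu * (Λ + t • D)) (𝓝 0) (𝓝 (A + Bu * Λ)) := by
      have : Continuous fun t : ℝ => A + Bu * (Λ + t • D) := by fun_prop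
      simpa using this.tendsto 0
    exact h1.add (hpc.const_mul (Ba * R⁻¹ * Baᵀ))
  have hLc : Tendsto (fun t => -((M t)ᵀ * S + S * M t)) (𝓝 0)
      (𝓝 (-((A + Bu * Λ + Ba * R⁻¹ * Baᵀ * P)ᵀ * S +
        S * (A + Bu * Λ + Ba * R⁻¹ * Baᵀ * P)))) := by
    have : Continuous fun X : Matrix (Fin n) (Fin n) ℝ => -(Xᵀ * S + S * X) := by fun_prop
    exact (this.tendsto _).comp hMc
  have hherm : ∀ X : Matrix (Fin n) (Fin n) ℝ, (-(Xᵀ * S + S * X)).IsHermitian := fun X => by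
    simp [IsHermitian, conjTranspose_eq_transpose_of_trivial, hST, add_comm]
  have hLpos := eventually_posDef hLc
    (PosDef.of_dotProduct_mulVec_pos (hherm _) fun x hx => by
      rw [star_trivial, neg_mulVec, dotProduct_neg]
      linarith [hSM x hx]) (Eventually.of_forall fun t => hherm _)
  filter_upwards [hsol, hposdef, hLpos] with t ht hpos hL
  refine ⟨hpos, ?_, isHurwitz_of_lyapunov hS fun x hx => ?_⟩
  · rw [hassoc, ← ht]
    simp only [Matrix.mul_add, Matrix.mul_smul]
    abel_nf
  · have := hL.dotProduct_mulVec_pos hx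
    rw [star_trivial, neg_mulVec, dotProduct_neg] at this
    exact neg_pos.mp this

/-- The gradient of the deception cost along the line through `Λ` with direction `D`. -/
lemma hasDerivAt_Jcost_line (hQ : Q.PosDef) (hR : R.PosDef) {Γ : Matrix (Fin m_u) (Fin m_u) ℝ}
    (hΓ : Γ.PosDef) {Kbar : Matrix (Fin m_a) (Fin n) ℝ}
    {Pu : Matrix (Fin m_u) (Fin n) ℝ → Matrix (Fin n) (Fin n) ℝ}
    (hPu : ∀ Λ, (∃ P, IsStabSol A Bu Ba Q R Λ P) → IsStabSol A Bu Ba Q R Λ (Pu Λ))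
    {Λ : Matrix (Fin m_u) (Fin n) ℝ} {Pim S : Matrix (Fin n) (Fin n) ℝ}
    (hΛ : IsStabSol A Bu Ba Q R Λ (Pu Λ)) (hPim : IsLyapSol A Bu Ba R Kbar Λ (Pu Λ) Pim)
    (hS : S.PosDef)
    (hSM : ∀ x : Fin n → ℝ, x ≠ 0 → x ⬝ᵥ (((A + Bu * Λ + Ba * R⁻¹ * Baᵀ * Pu Λ)ᵀ * S +
      S * (A + Bu * Λ + Ba * R⁻¹ * Baᵀ * Pu Λ)) *ᵥ x) < 0)
    (D : Matrix (Fin m_u) (Fin n) ℝ) :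
    (∀ᶠ t in 𝓝 (0 : ℝ), ∃ P, IsStabSol A Bu Ba Q R (Λ + t • D) P) ∧
    HasDerivAt (fun t : ℝ => Jcost Ba R Γ Kbar Pu (Λ + t • D))
      (2 * trace ((Γ * Λ + Buᵀ * Pu Λ * Pim)ᵀ * D)) 0 := by
  obtain ⟨p, p', hp0, hp, hp't, hstab, hderiv⟩ := exists_stabSol_branch hQ hR hΛ hS hSM D
  refine ⟨hstab.mono fun t ht => ⟨_, ht⟩, ?_⟩
  have hPT := transpose_eq_of_isHermitian hΛ.1.isHermitian
  have hPimT := transpose_eq_of_isHermitian hPim.1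
  have hRT := transpose_eq_of_isHermitian hR.inv.isHermitian
  have hK : HasDerivAt (fun t => R⁻¹ * Baᵀ * p t - Kbar) (R⁻¹ * Baᵀ * p') 0 :=
    (((mulLeftLinearMap (Fin n) ℝ (R⁻¹ * Baᵀ)).toContinuousLinearMap.hasFDerivAt.comp_hasDerivAt
      0 hp).sub_const Kbar)
  have hJ := (hasDerivAt_frobNorm_sq hK).add
    (hasDerivAt_trace_quadratic (transpose_eq_of_isHermitian hΓ.isHermitian) Λ D)
  refine (hJ.congr_deriv ?_).congr_of_eventuallyEq ?_
  · have key := trace_adjoint_identity (X := R⁻¹ * Baᵀ * Pu Λ - Kbar) (C := R⁻¹ * Baᵀ)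
      hPT hPimT hp't hderiv (by
        rw [← hPim.2]
        simp only [transpose_sub, transpose_mul, transpose_transpose, hRT, hPT, Matrix.sub_mul,
          Matrix.mul_sub, Matrix.mul_assoc]
        abel)
    have hfin : trace (Pim * Pu Λ * (Bu * D)) = trace ((Buᵀ * Pu Λ * Pim)ᵀ * D) := by
      simp only [transpose_mul, transpose_transpose, hPT, hPimT, Matrix.mul_assoc]
    rw [hp0, key, hfin, transpose_add, Matrix.add_mul, trace_add]
    ring
  · filter_upwards [hstab] with t ht
    simp only [Jcost, Pi.add_apply, IsStabSol.unique hR (hPu _ ⟨_, ht⟩) ht]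

lemma quadratic_congr_nonneg (hR : R.PosDef) (X : Matrix (Fin m_a) (Fin n) ℝ) (x : Fin n → ℝ) :
    0 ≤ x ⬝ᵥ ((Xᵀ * R⁻¹ * X) *ᵥ x) := by
  simpa [conjTranspose_eq_transpose_of_trivial] using
    (hR.inv.posSemidef.conjTranspose_mul_mul_same X).dotProduct_mulVec_nonneg x

lemma quadratic_stabSol_le (hR : R.PosDef) {Λ : Matrix (Fin m_u) (Fin n) ℝ}
    {P S : Matrix (Fin n) (Fin n) ℝ} (hP : IsStabSol A Bu Ba Q R Λ P) (hS : S.PosDef)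
    {δ : ℝ} (hδ : 0 < δ)
    (hSM : ∀ x : Fin n → ℝ, x ⬝ᵥ (((A + Bu * Λ + Ba * R⁻¹ * Baᵀ * P)ᵀ * S +
      S * (A + Bu * Λ + Ba * R⁻¹ * Baᵀ * P)) *ᵥ x) ≤ -δ * (x ⬝ᵥ x)) (x : Fin n → ℝ) :
    x ⬝ᵥ (P *ᵥ x) ≤ x ⬝ᵥ (((‖Q‖ / δ) • S) *ᵥ x) := by
  have hneg : ∀ x : Fin n → ℝ, x ≠ 0 → x ⬝ᵥ (((A + Bu * Λ + Ba * R⁻¹ * Baᵀ * P)ᵀ * S +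
      S * (A + Bu * Λ + Ba * R⁻¹ * Baᵀ * P)) *ᵥ x) < 0 := fun x hx => by
    have hxx : 0 < x ⬝ᵥ x := by
      simpa using (PosDef.one (n := Fin n) (R := ℝ)).dotProduct_mulVec_pos hx
    nlinarith [hSM x]
  have hlyap := closedLoop_lyapunov_eq hR (transpose_eq_of_isHermitian hP.1.isHermitian) hP.2.1
  have hherm : ((‖Q‖ / δ) • S).IsHermitian := by
    simp [IsHermitian, transpose_eq_of_isHermitian hS.isHermitian]
  have h := quadratic_nonneg_of_lyapunov (Y := (‖Q‖ / δ) • S - P) hS hneg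
    (hherm.sub hP.1.isHermitian) (fun y => ?_) x
  · rw [sub_mulVec, dotProduct_sub] at h
    linarith
  · have e : (A + Bu * Λ + Ba * R⁻¹ * Baᵀ * P)ᵀ * ((‖Q‖ / δ) • S - P) +
        ((‖Q‖ / δ) • S - P) * (A + Bu * Λ + Ba * R⁻¹ * Baᵀ * P) =
        (‖Q‖ / δ) • ((A + Bu * Λ + Ba * R⁻¹ * Baᵀ * P)ᵀ * S +
          S * (A + Bu * Λ + Ba * R⁻¹ * Baᵀ * P)) - ((Baᵀ * P)ᵀ * R⁻¹ * (Baᵀ * P) - Q) := by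
      rw [← hlyap, Matrix.mul_sub, Matrix.sub_mul, Matrix.mul_smul, Matrix.smul_mul, smul_add]
      abel
    rw [e, sub_mulVec, dotProduct_sub, smul_mulVec, dotProduct_smul, sub_mulVec, dotProduct_sub,
      smul_eq_mul]
    have h1 := mul_le_mul_of_nonneg_left (hSM y) (div_nonneg (norm_nonneg Q) hδ.le)
    have h2 := quadratic_congr_nonneg hR (Baᵀ * P) y
    have h3 := (abs_le.mp (abs_quadratic_le Q y)).2
    have h4 : ‖Q‖ / δ * (-δ * (y ⬝ᵥ y)) = -(‖Q‖ * (y ⬝ᵥ y)) := by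
      field_simp
    linarith

/-- If a single Lyapunov matrix certifies all closed loops over the sublevel set, then the
sublevel set is closed. -/
lemma isClosed_S0 (hQ : Q.PosDef) (hR : R.PosDef) {Γ : Matrix (Fin m_u) (Fin m_u) ℝ}
    {Kbar : Matrix (Fin m_a) (Fin n) ℝ}
    {Pu : Matrix (Fin m_u) (Fin n) ℝ → Matrix (Fin n) (Fin n) ℝ}
    (hPu : ∀ Λ, (∃ P, IsStabSol A Bu Ba Q R Λ P) → IsStabSol A Bu Ba Q R Λ (Pu Λ))
    {S : Matrix (Fin n) (Fin n) ℝ} (hS : S.PosDef) {δ : ℝ} (hδ : 0 < δ)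
    (hSM : ∀ Λ ∈ S0 A Bu Ba Q R Γ Kbar Pu, ∀ x : Fin n → ℝ,
      x ⬝ᵥ (((A + Bu * Λ + Ba * R⁻¹ * Baᵀ * Pu Λ)ᵀ * S +
        S * (A + Bu * Λ + Ba * R⁻¹ * Baᵀ * Pu Λ)) *ᵥ x) ≤ -δ * (x ⬝ᵥ x)) :
    IsClosed (S0 A Bu Ba Q R Γ Kbar Pu) := by
  have hfu : FrechetUrysohnSpace (Matrix (Fin m_u) (Fin n) ℝ) :=
    inferInstanceAs (FrechetUrysohnSpace (Fin m_u → Fin n → ℝ))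
  refine isClosed_of_closure_subset fun Λ hΛ => ?_
  obtain ⟨u, hu, hlim⟩ := mem_closure_iff_seq_limit.mp hΛ
  have hstab : ∀ k, IsStabSol A Bu Ba Q R (u k) (Pu (u k)) := fun k => hPu _ (hu k).1
  set C := ∑ i : Fin n, ∑ j : Fin n,
    (|((‖Q‖ / δ) • S) i i| + |((‖Q‖ / δ) • S) j j|) ^ 2 with hC
  have hbound : ∀ k, ‖Pu (u k)‖ ≤ √C := fun k => Real.le_sqrt_of_sq_le
    (norm_le_of_quadratic_le (hstab k).1.posSemidef
      (quadratic_stabSol_le hR (hstab k) hS hδ (hSM _ (hu k))))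
  have hproper : ProperSpace (Matrix (Fin n) (Fin n) ℝ) := FiniteDimensional.proper_real _
  obtain ⟨P, -, φ, hφ, hP⟩ := tendsto_subseq_of_bounded
    (Metric.isBounded_closedBall (x := (0 : Matrix (Fin n) (Fin n) ℝ)) (r := √C))
    (x := fun k => Pu (u k)) (fun k => by simpa using hbound k)
  exact mem_S0_of_tendsto hQ hR hPu hS hδ hSM (fun k => hu (φ k))
    (hlim.comp hφ.tendsto_atTop) hP

lemma eigMin_pos {m : ℕ} [Nonempty (Fin m)] {M : Matrix (Fin m) (Fin m) ℝ} (hM : M.PosDef) :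
    0 < eigMin M := by
  rw [eigMin, dif_pos hM.isHermitian]
  obtain ⟨i, hi⟩ := exists_eq_ciInf_of_finite (f := hM.isHermitian.eigenvalues)
  rw [← hi]
  exact hM.eigenvalues_pos i

/-- The Lyapunov matrix of the nominal closed loop certifies all closed loops over the sublevel
set when the nominal gain is close enough to the target gain. -/
lemma lyapunov_certificate_of_mem_S0 {Γ : Matrix (Fin m_u) (Fin m_u) ℝ}
    (hΓ : Γ.PosDef) (hΓ0 : 0 < eigMin Γ) {Kbar : Matrix (Fin m_a) (Fin n) ℝ}
    {Pu : Matrix (Fin m_u) (Fin n) ℝ → Matrix (Fin n) (Fin n) ℝ}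
    {S : Matrix (Fin n) (Fin n) ℝ} (hS : S.PosDef)
    (hSeq : (A + Ba * (R⁻¹ * Baᵀ * Pu 0))ᵀ * S + S * (A + Ba * (R⁻¹ * Baᵀ * Pu 0))
      + (2 : ℝ) • (1 : Matrix (Fin n) (Fin n) ℝ) = 0)
    {ε : ℝ} (hε0 : 0 < ε)
    (hdist : frobNorm (R⁻¹ * Baᵀ * Pu 0 - Kbar) ≤
      (ε / 2) * (Real.sqrt (eigMin Γ) /
        (Real.sqrt (eigMin Γ) * frobNorm (S * Ba) + frobNorm (S * Bu))))
    {Λ : Matrix (Fin m_u) (Fin n) ℝ} (hΛ : Λ ∈ S0 A Bu Ba Q R Γ Kbar Pu) (x : Fin n → ℝ) :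
    x ⬝ᵥ (((A + Bu * Λ + Ba * R⁻¹ * Baᵀ * Pu Λ)ᵀ * S +
      S * (A + Bu * Λ + Ba * R⁻¹ * Baᵀ * Pu Λ)) *ᵥ x) ≤ -(2 * (1 - ε)) * (x ⬝ᵥ x) := by
  have hJ := hΛ.2
  simp only [Jcost, frobNorm_eq_norm] at hJ hdist
  simp only [transpose_zero, Matrix.zero_mul, trace_zero, add_zero] at hJ
  have htr := eigMin_mul_norm_sq_le hΓ.isHermitian Λ
  rw [← Matrix.mul_assoc] at htr
  set s := √(eigMin Γ) with hs
  have hs0 : 0 < s := Real.sqrt_pos.mpr hΓ0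
  have hss : s ^ 2 = eigMin Γ := Real.sq_sqrt hΓ0.le
  rw [← hss] at htr
  set K₀ := R⁻¹ * Baᵀ * Pu 0 with hK₀
  set K := R⁻¹ * Baᵀ * Pu Λ with hK
  set d := ‖K₀ - Kbar‖ with hd
  have hd0 : 0 ≤ d := norm_nonneg _
  have h1 : ‖K - Kbar‖ ≤ d := by
    refine le_of_sq_le_sq ?_ hd0
    nlinarith [sq_nonneg (s * ‖Λ‖)]
  have h2 : s * ‖Λ‖ ≤ d := by
    refine le_of_sq_le_sq ?_ hd0
    nlinarith [sq_nonneg ‖K - Kbar‖]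
  have hsmall : d * (s * ‖S * Ba‖ + ‖S * Bu‖) ≤ ε / 2 * s := by
    have hc0 : 0 ≤ s * ‖S * Ba‖ + ‖S * Bu‖ := by positivity
    rcases hc0.eq_or_lt with hc | hc
    · rw [← hc, mul_zero]; positivity
    · rwa [← mul_div_assoc, le_div_iff₀ hc] at hdist
  have hKK : ‖K - K₀‖ ≤ 2 * d := by
    calc ‖K - K₀‖ = ‖(K - Kbar) - (K₀ - Kbar)‖ := by congr 1; abel
      _ ≤ ‖K - Kbar‖ + ‖K₀ - Kbar‖ := norm_sub_le _ _
      _ ≤ _ := by linarith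
  set W := Bu * Λ + Ba * (K - K₀) with hW
  have hSW : ‖S * W‖ ≤ ‖S * Bu‖ * ‖Λ‖ + ‖S * Ba‖ * ‖K - K₀‖ := by
    rw [hW, Matrix.mul_add, ← Matrix.mul_assoc, ← Matrix.mul_assoc]
    exact (norm_add_le _ _).trans
      (add_le_add (frobenius_norm_mul _ _) (frobenius_norm_mul _ _))
  have hSWε : ‖S * W‖ ≤ ε := by
    refine le_of_mul_le_mul_left ?_ hs0
    have a1 : ‖S * Bu‖ * (s * ‖Λ‖) ≤ ‖S * Bu‖ * d := by gcongr
    have a2 : s * ‖S * Ba‖ * ‖K - K₀‖ ≤ s * ‖S * Ba‖ * (2 * d) := by gcongr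
    have a3 := mul_le_mul_of_nonneg_left hSW hs0.le
    have a4 : 0 ≤ ‖S * Bu‖ * d := by positivity
    nlinarith
  have hdecomp : A + Bu * Λ + Ba * R⁻¹ * Baᵀ * Pu Λ = (A + Ba * K₀) + W := by
    rw [hW, Matrix.mul_sub, hK]
    simp only [Matrix.mul_assoc]
    abel
  have hq : x ⬝ᵥ (((A + Bu * Λ + Ba * R⁻¹ * Baᵀ * Pu Λ)ᵀ * S +
      S * (A + Bu * Λ + Ba * R⁻¹ * Baᵀ * Pu Λ)) *ᵥ x) =
      -2 * (x ⬝ᵥ x) + 2 * (x ⬝ᵥ ((S * W) *ᵥ x)) := by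
    have e := congrArg (fun X => x ⬝ᵥ (X *ᵥ x)) hSeq
    simp only [add_mulVec _ ((2 : ℝ) • _), dotProduct_add, smul_mulVec, one_mulVec, dotProduct_smul,
      smul_eq_mul, zero_mulVec, dotProduct_zero] at e
    rw [dotProduct_lyapunov_mulVec hS.isHermitian] at e
    rw [dotProduct_lyapunov_mulVec hS.isHermitian, hdecomp, add_mulVec, dotProduct_add,
      ← mulVec_mulVec, mulVec_dotProduct_comm_of_isHermitian hS.isHermitian]
    linarith
  rw [hq]
  have hxx : 0 ≤ x ⬝ᵥ x := by
    simpa using (PosSemidef.one (n := Fin n) (R := ℝ)).dotProduct_mulVec_nonneg x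
  have h3 := (abs_le.mp (abs_quadratic_le (S * W) x)).2
  nlinarith [mul_le_mul_of_nonneg_right hSWε hxx]

/-- A continuation argument: a function that strictly decreases along a closed set which can only
be left by increasing the function stays in that set and decreases linearly. -/
lemma mem_and_le_of_deriv_le {φ φ' : ℝ → ℝ} {s : Set ℝ} {ω c : ℝ} (hω : 0 < ω) (hc : 0 < c)
    (hs : IsClosed s) (h0 : (0 : ℝ) ∈ s)
    (hderiv : ∀ t ∈ s, 0 ≤ t → t ≤ ω → HasDerivAt φ (φ' t) t ∧ φ' t ≤ -c)
    (hnear : ∀ t ∈ s, ∀ᶠ r in 𝓝 t, φ r ≤ φ t → r ∈ s) :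
    ω ∈ s ∧ φ ω ≤ φ 0 - c * ω := by
  have hsub : Set.Icc 0 ω ⊆ s := by
    refine (hs.inter isClosed_Icc).Icc_subset_of_forall_mem_nhdsWithin h0 fun t ht => ?_
    obtain ⟨hd, hle⟩ := hderiv t ht.1 ht.2.1 ht.2.2.le
    have hslope : ∀ᶠ r in 𝓝[>] t, slope φ t r < 0 :=
      ((hasDerivAt_iff_tendsto_slope.mp hd).mono_left (nhdsWithin_mono t fun r hr => ne_of_gt hr))
        |>.eventually_lt_const (by linarith)
    filter_upwards [hslope, (hnear t ht.1).filter_mono nhdsWithin_le_nhds, self_mem_nhdsWithin]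
      with r h1 h2 h3
    refine h2 ?_
    rw [slope_def_field, div_neg_iff] at h1
    have h4 : t < r := h3
    rcases h1 with h1 | h1 <;> linarith [h1.1, h1.2]
  have hd : ∀ t ∈ Set.Icc 0 ω, HasDerivAt φ (φ' t) t ∧ φ' t ≤ -c :=
    fun t ht => hderiv t (hsub ht) ht.1 ht.2
  refine ⟨hsub ⟨hω.le, le_rfl⟩, ?_⟩
  obtain ⟨t, ht, he⟩ := exists_hasDerivAt_eq_slope φ φ' hω
    (fun t ht => (hd t ht).1.continuousAt.continuousWithinAt)
    (fun t ht => (hd t (Set.Ioo_subset_Icc_self ht)).1)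
  have hle := (hd t (Set.Ioo_subset_Icc_self ht)).2
  rw [he, sub_zero, div_le_iff₀ hω] at hle
  linarith

/-- One step of the preconditioned gradient iteration stays in the sublevel set and decreases the
cost by a multiple of the squared gradient norm. -/
lemma step_mem_S0_and_descent (hQ : Q.PosDef) (hR : R.PosDef) {Γ : Matrix (Fin m_u) (Fin m_u) ℝ}
    (hΓ : Γ.PosDef) {Kbar : Matrix (Fin m_a) (Fin n) ℝ}
    {Pu Pim : Matrix (Fin m_u) (Fin n) ℝ → Matrix (Fin n) (Fin n) ℝ}
    (hPu : ∀ Λ, (∃ P, IsStabSol A Bu Ba Q R Λ P) → IsStabSol A Bu Ba Q R Λ (Pu Λ))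
    (hPim : ∀ Λ, (∃ P, IsStabSol A Bu Ba Q R Λ P) →
      IsLyapSol A Bu Ba R Kbar Λ (Pu Λ) (Pim Λ))
    {S : Matrix (Fin n) (Fin n) ℝ} (hS : S.PosDef) {δ : ℝ} (hδ : 0 < δ)
    (hSM : ∀ Λ ∈ S0 A Bu Ba Q R Γ Kbar Pu, ∀ x : Fin n → ℝ,
      x ⬝ᵥ (((A + Bu * Λ + Ba * R⁻¹ * Baᵀ * Pu Λ)ᵀ * S +
        S * (A + Bu * Λ + Ba * R⁻¹ * Baᵀ * Pu Λ)) *ᵥ x) ≤ -δ * (x ⬝ᵥ x))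
    {L : ℝ} (hL : 0 < L)
    (hLip : ∀ Λ₁ ∈ S0 A Bu Ba Q R Γ Kbar Pu, ∀ Λ₂ ∈ S0 A Bu Ba Q R Γ Kbar Pu,
      frobNorm ((2 : ℝ) • (Γ * Λ₁ + Buᵀ * Pu Λ₁ * Pim Λ₁) -
          (2 : ℝ) • (Γ * Λ₂ + Buᵀ * Pu Λ₂ * Pim Λ₂)) ≤ L * frobNorm (Λ₁ - Λ₂))
    {ω : ℝ} (hω0 : 0 < ω) (hc : 0 < 2 * eigMin Γ⁻¹ - L * ω * eigMax Γ⁻¹ ^ 2)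
    {Λ Λ' : Matrix (Fin m_u) (Fin n) ℝ} (hΛ : Λ ∈ S0 A Bu Ba Q R Γ Kbar Pu)
    (hΛ' : Λ' = Λ + ω • (-(Γ⁻¹ * (Buᵀ * Pu Λ * Pim Λ)) - Λ)) :
    Λ' ∈ S0 A Bu Ba Q R Γ Kbar Pu ∧
    Jcost Ba R Γ Kbar Pu Λ' ≤ Jcost Ba R Γ Kbar Pu Λ -
      (2 * eigMin Γ⁻¹ - L * ω * eigMax Γ⁻¹ ^ 2) * ω *
        frobNorm (Γ * Λ + Buᵀ * Pu Λ * Pim Λ) ^ 2 := by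
  simp only [frobNorm_eq_norm] at hLip ⊢
  set G : Matrix (Fin m_u) (Fin n) ℝ → Matrix (Fin m_u) (Fin n) ℝ :=
    fun X => Γ * X + Buᵀ * Pu X * Pim X with hG
  change _ ∧ _ ≤ _ - _ * ω * ‖G Λ‖ ^ 2
  have hLipG : ∀ X ∈ S0 A Bu Ba Q R Γ Kbar Pu, ∀ Y ∈ S0 A Bu Ba Q R Γ Kbar Pu,
      ‖(2 : ℝ) • G X - (2 : ℝ) • G Y‖ ≤ L * ‖X - Y‖ := hLip
  set D : Matrix (Fin m_u) (Fin n) ℝ := -(Γ⁻¹ * G Λ) with hD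
  have hstep : Λ' = Λ + ω • D := by
    have hinv : Γ⁻¹ * (Γ * Λ) = Λ := by
      rw [← Matrix.mul_assoc, nonsing_inv_mul _ ((isUnit_iff_isUnit_det _).mp hΓ.isUnit),
        Matrix.one_mul]
    rw [hΛ', hD, hG, Matrix.mul_add, hinv]
    congr 2
    abel
  by_cases hG0 : G Λ = 0
  · have hΛeq : Λ' = Λ := by rw [hstep, hD, hG0]; simp
    rw [hΛeq, hG0]
    exact ⟨hΛ, by simp⟩
  have hGpos : 0 < ‖G Λ‖ ^ 2 := pow_pos (norm_pos_iff.mpr hG0) 2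
  have hDnorm : ‖D‖ ^ 2 ≤ eigMax Γ⁻¹ ^ 2 * ‖G Λ‖ ^ 2 := by
    rw [hD, norm_neg]
    exact norm_mul_sq_le_eigMax_sq hΓ.inv.posSemidef _
  have hGD : trace ((G Λ)ᵀ * D) ≤ -(eigMin Γ⁻¹ * ‖G Λ‖ ^ 2) := by
    rw [hD, Matrix.mul_neg, trace_neg]
    exact neg_le_neg (eigMin_mul_norm_sq_le hΓ.inv.isHermitian _)
  have hcont : Continuous fun t : ℝ => Λ + t • D := by fun_prop
  have hneg : ∀ X ∈ S0 A Bu Ba Q R Γ Kbar Pu, ∀ x : Fin n → ℝ, x ≠ 0 →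
      x ⬝ᵥ (((A + Bu * X + Ba * R⁻¹ * Baᵀ * Pu X)ᵀ * S +
        S * (A + Bu * X + Ba * R⁻¹ * Baᵀ * Pu X)) *ᵥ x) < 0 := fun X hX x hx => by
    have hxx : 0 < x ⬝ᵥ x := by
      simpa using (PosDef.one (n := Fin n) (R := ℝ)).dotProduct_mulVec_pos hx
    nlinarith [hSM X hX x]
  have hline : ∀ t ∈ (fun t : ℝ => Λ + t • D) ⁻¹' S0 A Bu Ba Q R Γ Kbar Pu,
      (∀ᶠ r in 𝓝 t, ∃ P, IsStabSol A Bu Ba Q R (Λ + r • D) P) ∧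
      HasDerivAt (fun r : ℝ => Jcost Ba R Γ Kbar Pu (Λ + r • D))
        (2 * trace ((G (Λ + t • D))ᵀ * D)) t := fun t ht => by
    obtain ⟨h1, h2⟩ := hasDerivAt_Jcost_line hQ hR hΓ hPu (hPu _ ht.1) (hPim _ ht.1) hS
      (hneg _ ht) D
    have hshift : ∀ r : ℝ, Λ + t • D + (r - t) • D = Λ + r • D := fun r => by
      rw [sub_smul]; abel
    have hlim : Tendsto (fun r : ℝ => r - t) (𝓝 t) (𝓝 0) := by
      simpa using (continuous_sub_right t).tendsto t
    refine ⟨(hlim.eventually h1).mono fun r hr => by rwa [hshift] at hr, ?_⟩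
    have h3 := HasDerivAt.comp_sub_const (x := t) (a := t) (by rwa [sub_self])
    simp only [hshift] at h3
    exact h3
  rw [hstep]
  have hmain := mem_and_le_of_deriv_le (φ := fun t : ℝ => Jcost Ba R Γ Kbar Pu (Λ + t • D))
    (φ' := fun t => 2 * trace ((G (Λ + t • D))ᵀ * D))
    (s := (fun t : ℝ => Λ + t • D) ⁻¹' S0 A Bu Ba Q R Γ Kbar Pu)
    hω0 (mul_pos hc hGpos) ((isClosed_S0 hQ hR hPu hS hδ hSM).preimage hcont) (by simpa using hΛ)
    (fun t ht ht0 htω => ⟨(hline t ht).2, ?_⟩)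
    (fun t ht => (hline t ht).1.mono fun r hr hle => ⟨hr, hle.trans ht.2⟩)
  · refine ⟨hmain.1, hmain.2.trans (le_of_eq ?_)⟩
    simp only [zero_smul, add_zero]
    ring
  · have hsplit : 2 * trace ((G (Λ + t • D))ᵀ * D) =
        trace (((2 : ℝ) • G (Λ + t • D) - (2 : ℝ) • G Λ)ᵀ * D) + 2 * trace ((G Λ)ᵀ * D) := by
      simp only [transpose_sub, transpose_smul, Matrix.sub_mul, Matrix.smul_mul, trace_sub,
        trace_smul, smul_eq_mul]
      ring
    have h1 := trace_transpose_mul_le ((2 : ℝ) • G (Λ + t • D) - (2 : ℝ) • G Λ) D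
    have h2 : ‖(2 : ℝ) • G (Λ + t • D) - (2 : ℝ) • G Λ‖ ≤ L * (ω * ‖D‖) := by
      refine (hLipG _ ht _ hΛ).trans (mul_le_mul_of_nonneg_left ?_ hL.le)
      rw [add_sub_cancel_left, norm_smul, Real.norm_of_nonneg ht0]
      exact mul_le_mul_of_nonneg_right htω (norm_nonneg D)
    have h3 := mul_le_mul_of_nonneg_right h2 (norm_nonneg D)
    have h4 := mul_le_mul_of_nonneg_left hDnorm (mul_pos hL hω0).le
    simp only [hsplit]
    nlinarith

lemma Jcost_nonneg {Γ : Matrix (Fin m_u) (Fin m_u) ℝ} (hΓ : Γ.PosDef)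
    (Kbar : Matrix (Fin m_a) (Fin n) ℝ)
    (Pu : Matrix (Fin m_u) (Fin n) ℝ → Matrix (Fin n) (Fin n) ℝ) (Λ : Matrix (Fin m_u) (Fin n) ℝ) :
    0 ≤ Jcost Ba R Γ Kbar Pu Λ := by
  have h := (hΓ.posSemidef.conjTranspose_mul_mul_same Λ).trace_nonneg
  rw [conjTranspose_eq_transpose_of_trivial] at h
  exact add_nonneg (sq_nonneg _) h

end SpoofedARE

/-- A sequence whose squares are dominated by the decrements of a nonnegative sequence tends to
zero. -/
lemma tendsto_zero_of_sq_le_decrement {J g : ℕ → ℝ} {c : ℝ} (hc : 0 < c) (hJ : ∀ i, 0 ≤ J i)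
    (h : ∀ i, J (i + 1) ≤ J i - c * g i ^ 2) : Tendsto g atTop (𝓝 0) := by
  have hanti : Antitone J := antitone_nat_of_succ_le fun i => by
    have := mul_nonneg hc.le (sq_nonneg (g i))
    linarith [h i]
  have hlim := tendsto_atTop_ciInf hanti ⟨0, by rintro _ ⟨i, rfl⟩; exact hJ i⟩
  have hdiff : Tendsto (fun i => (J i - J (i + 1)) / c) atTop (𝓝 0) := by
    simpa using (hlim.sub (hlim.comp (tendsto_add_atTop_nat 1))).div_const c
  have hsq : Tendsto (fun i => g i ^ 2) atTop (𝓝 0) :=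
    squeeze_zero (fun i => sq_nonneg (g i))
      (fun i => by rw [le_div_iff₀ hc]; linarith [h i]) hdiff
  have hsqrt := hsq.sqrt
  simp only [Real.sqrt_sq_eq_abs, Real.sqrt_zero] at hsqrt
  exact (tendsto_zero_iff_abs_tendsto_zero g).mpr hsqrt

/-- Theorem 2, item 3: the gradients (equivalently, the
stationarity residuals `ΓΛ^i + BuᵀP_u(Λ^i)Π(Λ^i)`) vanish in the limit. -/
theorem stmt8
    (A : Matrix (Fin n) (Fin n) ℝ) (Bu : Matrix (Fin n) (Fin m_u) ℝ)
    (Ba : Matrix (Fin n) (Fin m_a) ℝ)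
    (Q : Matrix (Fin n) (Fin n) ℝ) (R : Matrix (Fin m_a) (Fin m_a) ℝ)
    (Γ : Matrix (Fin m_u) (Fin m_u) ℝ)
    (hQ : Q.PosDef) (hR : R.PosDef) (hΓ : Γ.PosDef)
    (Kbar : Matrix (Fin m_a) (Fin n) ℝ)
    (Pu Pim : Matrix (Fin m_u) (Fin n) ℝ → Matrix (Fin n) (Fin n) ℝ)
    (hPu : ∀ Λ, (∃ P, IsStabSol A Bu Ba Q R Λ P) → IsStabSol A Bu Ba Q R Λ (Pu Λ))
    (hPim : ∀ Λ, (∃ P, IsStabSol A Bu Ba Q R Λ P) →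
      IsLyapSol A Bu Ba R Kbar Λ (Pu Λ) (Pim Λ))
    (h0 : ∃ P, IsStabSol A Bu Ba Q R 0 P)
    (S : Matrix (Fin n) (Fin n) ℝ) (hS : S.PosDef)
    (hSeq : (A + Ba * (R⁻¹ * Baᵀ * Pu 0))ᵀ * S + S * (A + Ba * (R⁻¹ * Baᵀ * Pu 0))
      + (2 : ℝ) • (1 : Matrix (Fin n) (Fin n) ℝ) = 0)
    (ε : ℝ) (hε0 : 0 < ε) (hε1 : ε < 1)
    (hdist : frobNorm (R⁻¹ * Baᵀ * Pu 0 - Kbar) ≤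
      (ε / 2) * (Real.sqrt (eigMin Γ) /
        (Real.sqrt (eigMin Γ) * frobNorm (S * Ba) + frobNorm (S * Bu))))
    (L : ℝ) (hL : 0 < L)
    (hLip : ∀ Λ₁ ∈ S0 A Bu Ba Q R Γ Kbar Pu, ∀ Λ₂ ∈ S0 A Bu Ba Q R Γ Kbar Pu,
      frobNorm ((2 : ℝ) • (Γ * Λ₁ + Buᵀ * Pu Λ₁ * Pim Λ₁) -
          (2 : ℝ) • (Γ * Λ₂ + Buᵀ * Pu Λ₂ * Pim Λ₂)) ≤ L * frobNorm (Λ₁ - Λ₂))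
    (ω : ℝ) (hω0 : 0 < ω)
    (hω : ω < (2 / L) * (eigMin Γ⁻¹ / (eigMax Γ⁻¹) ^ 2))
    (Λseq : ℕ → Matrix (Fin m_u) (Fin n) ℝ)
    (hinit : Λseq 0 ∈ S0 A Bu Ba Q R Γ Kbar Pu)
    (hstep : ∀ i, Λseq (i + 1) = Λseq i +
      ω • (-(Γ⁻¹ * (Buᵀ * Pu (Λseq i) * Pim (Λseq i))) - Λseq i)) :
    Filter.Tendsto
      (fun i => frobNorm (Γ * Λseq i + Buᵀ * Pu (Λseq i) * Pim (Λseq i)))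
      Filter.atTop (nhds 0) := by
  have hquot : 0 < eigMin Γ⁻¹ / eigMax Γ⁻¹ ^ 2 :=
    pos_of_mul_pos_right (hω0.trans hω) (by positivity)
  have hmax : 0 < eigMax Γ⁻¹ ^ 2 := by
    refine lt_of_le_of_ne (sq_nonneg _) fun h => ?_
    rw [← h, div_zero] at hquot
    exact lt_irrefl 0 hquot
  have hne : Nonempty (Fin m_u) := by
    by_contra hempty
    rw [not_nonempty_iff] at hempty
    rw [eigMax, dif_pos hΓ.inv.isHermitian, Real.iSup_of_isEmpty] at hmax
    norm_num at hmax
  have hc : 0 < 2 * eigMin Γ⁻¹ - L * ω * eigMax Γ⁻¹ ^ 2 := by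
    rw [div_mul_div_comm, lt_div_iff₀ (mul_pos hL hmax)] at hω
    linarith
  have hSM := fun Λ hΛ x => lyapunov_certificate_of_mem_S0 (A := A) (Q := Q) hΓ (eigMin_pos hΓ)
    hS hSeq hε0 hdist (Λ := Λ) hΛ x
  have hdescent := fun Λ Λ' hΛ hΛ' => step_mem_S0_and_descent hQ hR hΓ hPu hPim hS
    (by linarith : 0 < 2 * (1 - ε)) hSM hL hLip hω0 hc (Λ := Λ) (Λ' := Λ') hΛ hΛ'
  have hmem : ∀ i, Λseq i ∈ S0 A Bu Ba Q R Γ Kbar Pu := fun i => by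
    induction i with
    | zero => exact hinit
    | succ i ih => exact (hdescent _ _ ih (hstep i)).1
  exact tendsto_zero_of_sq_le_decrement (J := fun i => Jcost Ba R Γ Kbar Pu (Λseq i))
    (mul_pos hc hω0) (fun i => Jcost_nonneg hΓ Kbar Pu (Λseq i))
    fun i => (hdescent _ _ (hmem i) (hstep i)).2
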